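/- Liouville's theorem: the flow of a Hamiltonian vector field preserves Lebesgue measure; i.e., if Φ_t is the flow of the vector field X(q,p) = (∂_p H, −∂_q H) on ℝ^{2n} and Φ_t is defined globally, then for every Borel set A, λ(Φ_t(A)) = λ(A). -/

import Mathlib

open MeasureTheory
open Set Metric Filter Topology
open scoped NNReal

section Flow

variable {E : Type*} [NormedAddCommGroup E] [NormedSpace ℝ E]

theorem integralCurve_unique_of_contDiff {X : E → E} (hX : ContDiff ℝ 1 X) {f g : ℝ → E}
    (hf : ∀ t, HasDerivAt f (X (f t)) t) (hg : ∀ t, HasDerivAt g (X (g t)) t) {t₀ : ℝ}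
    (h : f t₀ = g t₀) : f = g := by
  have hfc : Continuous f := continuous_iff_continuousAt.2 fun t => (hf t).continuousAt
  have hgc : Continuous g := continuous_iff_continuousAt.2 fun t => (hg t).continuousAt
  have hclopen : IsClopen {t | f t = g t} := by
    refine ⟨isClosed_eq hfc hgc, isOpen_iff_mem_nhds.2 fun t ht => ?_⟩
    obtain ⟨K, s, hs, hK⟩ := hX.contDiffAt.exists_lipschitzOnWith (x := f t)
    have hgs : s ∈ 𝓝 (g t) := by rwa [← show f t = g t from ht]
    exact ODE_solution_unique_of_eventually (v := fun _ => X) (s := fun _ => s)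
      (Eventually.of_forall fun _ => hK)
      ((hfc.continuousAt.eventually hs).mono fun τ hτ => ⟨hf τ, hτ⟩)
      ((hgc.continuousAt.eventually hgs).mono fun τ hτ => ⟨hg τ, hτ⟩) ht
  have huniv := hclopen.eq_univ ⟨t₀, h⟩
  exact funext fun t => (huniv ▸ mem_univ t : t ∈ {t | f t = g t})

theorem flow_add_of_contDiff {X : E → E} (hX : ContDiff ℝ 1 X) {Φ : ℝ → E → E}
    (hΦ0 : ∀ x, Φ 0 x = x) (hΦ : ∀ x t, HasDerivAt (fun s => Φ s x) (X (Φ t x)) t)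
    (s t : ℝ) (x : E) : Φ (s + t) x = Φ s (Φ t x) :=
  congrFun (integralCurve_unique_of_contDiff hX (f := fun s => Φ (s + t) x)
    (g := fun s => Φ s (Φ t x)) (t₀ := 0) (fun s => (hΦ x (s + t)).comp_add_const s t)
    (hΦ _) (by simp [hΦ0])) s

/-- Short-time existence of the resolvent of a linear differential equation. -/
theorem exists_hasDerivWithinAt_linear [CompleteSpace E] {A : ℝ → E →L[ℝ] E} {ε : ℝ} {K : ℝ≥0}
    (hε : 0 ≤ ε) (hA : ContinuousOn A (Icc 0 ε)) (hK : ∀ t ∈ Icc 0 ε, ‖A t‖ ≤ K)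
    (hKε : 2 * (K * ε) ≤ 1) :
    ∃ M : ℝ → E →L[ℝ] E, M 0 = ContinuousLinearMap.id ℝ E ∧
      ∀ t ∈ Icc 0 ε, HasDerivWithinAt M ((A t).comp (M t)) (Icc 0 ε) t := by
  have hPL : IsPicardLindelof (fun t (M : E →L[ℝ] E) => (A t).comp M)
      (⟨0, left_mem_Icc.2 hε⟩ : Icc (0 : ℝ) ε) (ContinuousLinearMap.id ℝ E) 1 0 (K * 2) K := by
    refine ⟨fun t ht => ?_, fun M _ => hA.clm_comp continuousOn_const, fun t ht M hM => ?_, ?_⟩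
    · refine LipschitzOnWith.of_dist_le_mul fun M _ N _ => ?_
      rw [dist_eq_norm, dist_eq_norm, ← ContinuousLinearMap.comp_sub]
      exact ((A t).opNorm_comp_le _).trans (by gcongr; exact hK t ht)
    · have hM2 : ‖M‖ ≤ 2 := by
        have h1 : ‖M - ContinuousLinearMap.id ℝ E‖ ≤ 1 := by simpa [dist_eq_norm] using hM
        have h2 : ‖ContinuousLinearMap.id ℝ E‖ ≤ 1 := ContinuousLinearMap.norm_id_le
        have h3 := norm_add_le (M - ContinuousLinearMap.id ℝ E) (ContinuousLinearMap.id ℝ E)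
        rw [sub_add_cancel] at h3
        linarith
      refine ((A t).opNorm_comp_le _).trans ?_
      push_cast
      gcongr
      exact hK t ht
    · simp only [sub_zero, sub_self, max_eq_left hε]
      push_cast
      linarith
  exact hPL.exists_eq_forall_mem_Icc_hasDerivWithinAt₀

/-- Solutions starting in the half ball stay in the ball for a short time. -/
theorem flow_mem_closedBall {X : E → E} {Φ : ℝ → E → E}
    (hΦ0 : ∀ x, Φ 0 x = x) (hΦ : ∀ x t, HasDerivAt (fun s => Φ s x) (X (Φ t x)) t)
    {y₀ y : E} {R C ε : ℝ} (hC : ∀ x ∈ closedBall y₀ R, ‖X x‖ < C) (hC0 : 0 ≤ C)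
    (hε : C * ε ≤ R / 2) (hy : y ∈ closedBall y₀ (R / 2)) {t : ℝ} (ht : t ∈ Icc 0 ε) :
    Φ t y ∈ closedBall y₀ R := by
  have hle : ∀ t ∈ Icc 0 ε, R / 2 + C * t ≤ R := fun t ht => by
    have := mul_le_mul_of_nonneg_left ht.2 hC0
    linarith
  have hd : ∀ t, HasDerivAt (fun s => Φ s y - y₀) (X (Φ t y)) t := fun t => (hΦ y t).sub_const _
  have key := image_norm_le_of_norm_deriv_right_lt_deriv_boundary (a := 0) (b := ε)
    (f := fun s => Φ s y - y₀) (B := fun s => R / 2 + C * s) (B' := fun _ => C)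
    (fun t _ => (hd t).continuousAt.continuousWithinAt) (fun t _ => (hd t).hasDerivWithinAt)
    (by simpa [hΦ0, dist_eq_norm] using hy)
    (fun t => by simpa using ((hasDerivAt_id t).const_mul C).const_add (R / 2))
    (fun t ht h => hC _ (by
      rw [mem_closedBall, dist_eq_norm, h]
      exact hle t (Ico_subset_Icc_self ht)))
  rw [mem_closedBall, dist_eq_norm]
  exact (key ht).trans (hle t ht)

/-- A solution of the variational equation is the spatial derivative of the flow. -/
theorem hasFDerivAt_flow_of_variational {X : E → E} (hX : ContDiff ℝ 1 X) {Φ : ℝ → E → E}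
    (hΦ0 : ∀ x, Φ 0 x = x) (hΦ : ∀ x t, HasDerivAt (fun s => Φ s x) (X (Φ t x)) t)
    {s : Set E} (hs : Convex ℝ s) (hsu : UniformContinuousOn (fderiv ℝ X) s) {K : ℝ≥0}
    (hK : ∀ x ∈ s, ‖fderiv ℝ X x‖ ≤ K) {y : E} {ε : ℝ}
    (hy : ∀ᶠ z in 𝓝 y, ∀ t ∈ Icc 0 ε, Φ t z ∈ s) {M : ℝ → E →L[ℝ] E}
    (hM0 : M 0 = ContinuousLinearMap.id ℝ E)
    (hM : ∀ t ∈ Icc 0 ε, HasDerivWithinAt M ((fderiv ℝ X (Φ t y)).comp (M t)) (Icc 0 ε) t)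
    {t : ℝ} (ht : t ∈ Icc 0 ε) : HasFDerivAt (Φ t) (M t) y := by
  have hXd : ∀ x, HasFDerivAt X (fderiv ℝ X x) x := fun x =>
    (hX.differentiable (by norm_num) x).hasFDerivAt
  have hcont : ∀ z, Continuous fun s => Φ s z := fun z =>
    continuous_iff_continuousAt.2 fun t => (hΦ z t).continuousAt
  have hLip : LipschitzOnWith K X s := hs.lipschitzOnWith_of_nnnorm_hasFDerivWithin_le
    (fun x _ => (hXd x).hasFDerivWithinAt) fun x hx => by exact_mod_cast hK x hx
  have hyt := hy.self_of_nhds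
  set c := Real.exp (K * ε) with hc
  have hgrow : ∀ᶠ z in 𝓝 y, ∀ t ∈ Icc 0 ε, dist (Φ t z) (Φ t y) ≤ dist z y * c := by
    filter_upwards [hy] with z hz t ht
    refine (dist_le_of_trajectories_ODE_of_mem (v := fun _ => X) (s := fun _ => s) (K := K)
      (a := 0) (b := ε) (fun _ _ => hLip) (hcont z).continuousOn
      (fun t _ => (hΦ z t).hasDerivWithinAt) (fun t ht => hz t (Ico_subset_Icc_self ht))
      (hcont y).continuousOn (fun t _ => (hΦ y t).hasDerivWithinAt)
      (fun t ht => hyt t (Ico_subset_Icc_self ht)) (by rw [hΦ0, hΦ0]) t ht).trans ?_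
    rw [sub_zero, hc]
    gcongr
    exact ht.2
  rw [hasFDerivAt_iff_isLittleO, Asymptotics.isLittleO_iff]
  intro η hη
  set D := Real.exp ((K + 1) * t) / (K + 1) with hD
  have hD0 : 0 < D := by positivity
  have hc0 : 0 < c := Real.exp_pos _
  set η' := η / (D * c) with hη'
  have hη'0 : 0 < η' := by positivity
  obtain ⟨δ, hδ, hδs⟩ := Metric.uniformContinuousOn_iff.1 hsu η' hη'0
  have htaylor : ∀ a ∈ s, ∀ b ∈ s, dist b a < δ →
      ‖X b - X a - fderiv ℝ X a (b - a)‖ ≤ η' * ‖b - a‖ := fun a ha b hb hab =>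
    (hs.inter (convex_ball a δ)).norm_image_sub_le_of_norm_hasFDerivWithin_le'
      (fun x _ => (hXd x).hasFDerivWithinAt)
      (fun x hx => (dist_eq_norm (fderiv ℝ X x) _) ▸ (hδs x hx.1 a ha hx.2).le)
      ⟨ha, mem_ball_self hδ⟩ ⟨hb, hab⟩
  have hsmall : ∀ᶠ z in 𝓝 y, dist z y * c < δ := by
    filter_upwards [ball_mem_nhds y (div_pos hδ hc0)] with z hz
    exact (lt_div_iff₀ hc0).1 hz
  filter_upwards [hy, hgrow, hsmall] with z hz hzg hzδ
  have hMc : ContinuousOn M (Icc 0 ε) := fun τ hτ => (hM τ hτ).continuousWithinAt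
  have hgw := norm_le_gronwallBound_of_norm_deriv_right_le (a := 0) (b := ε) (δ := 0) (K := K + 1)
    (ε := η' * (dist z y * c))
    (f := fun τ => Φ τ z - Φ τ y - M τ (z - y))
    (f' := fun τ => X (Φ τ z) - X (Φ τ y) - ((fderiv ℝ X (Φ τ y)).comp (M τ)) (z - y))
    (((hcont z).sub (hcont y)).continuousOn.sub (hMc.clm_apply continuousOn_const))
    (fun τ hτ => (((hΦ z τ).sub (hΦ y τ)).hasDerivWithinAt).sub
      (by
        have := ((hM τ (Ico_subset_Icc_self hτ)).mono_of_mem_nhdsWithin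
          (Icc_mem_nhdsGE_of_mem hτ)).clm_apply (hasDerivWithinAt_const τ (Ici τ) (z - y))
        simpa using this))
    (by simp [hΦ0, hM0])
    (fun τ hτ => by
      have hτ' := Ico_subset_Icc_self hτ
      have h1 := htaylor _ (hyt τ hτ') _ (hz τ hτ') ((hzg τ hτ').trans_lt hzδ)
      have h2 := hzg τ hτ'
      rw [dist_eq_norm] at h2
      set e := Φ τ z - Φ τ y - M τ (z - y) with he
      have h3 : ‖fderiv ℝ X (Φ τ y) e‖ ≤ (K + 1) * ‖e‖ :=
        (ContinuousLinearMap.le_opNorm _ _).trans (by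
          gcongr
          linarith [hK _ (hyt τ hτ')])
      have h4 : X (Φ τ z) - X (Φ τ y) - ((fderiv ℝ X (Φ τ y)).comp (M τ)) (z - y) =
          fderiv ℝ X (Φ τ y) e +
            (X (Φ τ z) - X (Φ τ y) - fderiv ℝ X (Φ τ y) (Φ τ z - Φ τ y)) := by
        rw [he, map_sub _ (Φ τ z - Φ τ y), ContinuousLinearMap.comp_apply]
        abel
      rw [h4]
      exact (norm_add_le _ _).trans (add_le_add h3 (h1.trans (by gcongr)))) t ht
  refine hgw.trans ?_
  have hK1 : (K : ℝ) + 1 ≠ 0 := by positivity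
  simp only [gronwallBound_of_K_ne_0 hK1, zero_mul, zero_add, sub_zero, ← dist_eq_norm]
  calc η' * (dist z y * c) / (K + 1) * (Real.exp ((K + 1) * t) - 1)
      ≤ η' * (dist z y * c) / (K + 1) * Real.exp ((K + 1) * t) := by
        gcongr
        linarith
    _ = η' * (D * c) * dist z y := by rw [hD]; ring
    _ = η * dist z y := by rw [hη', div_mul_cancel₀ _ (by positivity)]

/-- A bilinear form infinitesimally invariant under a linear differential equation is invariant
under its resolvent. -/
theorem bilin_invariant_of_variational {A M : ℝ → E →L[ℝ] E} {ε : ℝ} {B : E →L[ℝ] E →L[ℝ] ℝ}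
    (hB : ∀ t u v, B (A t u) v + B u (A t v) = 0) (hM0 : M 0 = ContinuousLinearMap.id ℝ E)
    (hM : ∀ t ∈ Icc 0 ε, HasDerivWithinAt M ((A t).comp (M t)) (Icc 0 ε) t) (u v : E) {t : ℝ}
    (ht : t ∈ Icc 0 ε) : B (M t u) (M t v) = B u v := by
  have hMw : ∀ w, ∀ τ ∈ Icc 0 ε,
      HasDerivWithinAt (fun τ => M τ w) (A τ (M τ w)) (Icc 0 ε) τ := fun w τ hτ => by
    simpa using (hM τ hτ).clm_apply (hasDerivWithinAt_const τ (Icc 0 ε) w)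
  have hderiv : ∀ τ ∈ Icc 0 ε,
      HasDerivWithinAt (fun τ => B (M τ u) (M τ v)) 0 (Icc 0 ε) τ := fun τ hτ => by
    have h := (B.hasFDerivAt.comp_hasDerivWithinAt τ (hMw u τ hτ)).clm_apply (hMw v τ hτ)
    exact h.congr_deriv (hB τ (M τ u) (M τ v))
  have hconst := constant_of_has_deriv_right_zero (fun τ hτ => (hderiv τ hτ).continuousWithinAt)
    (fun τ hτ => (hderiv τ (Ico_subset_Icc_self hτ)).mono_of_mem_nhdsWithin
      (Icc_mem_nhdsGE_of_mem hτ)) t ht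
  simpa [hM0] using hconst

/-- A bilinear form infinitesimally invariant along a vector field is invariant under the derivative
of its flow for short times. -/
theorem exists_hasFDerivAt_flow_short_time [FiniteDimensional ℝ E] {X : E → E}
    (hX : ContDiff ℝ 1 X) {Φ : ℝ → E → E} (hΦ0 : ∀ x, Φ 0 x = x)
    (hΦ : ∀ x t, HasDerivAt (fun s => Φ s x) (X (Φ t x)) t) {B : E →L[ℝ] E →L[ℝ] ℝ}
    (hB : ∀ x u v, B (fderiv ℝ X x u) v + B u (fderiv ℝ X x v) = 0) (y₀ : E) :
    ∃ ε > 0, ∀ᶠ y in 𝓝 y₀, ∀ t ∈ Icc 0 ε,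
      ∃ L : E →L[ℝ] E, HasFDerivAt (Φ t) L y ∧ ∀ u v, B (L u) (L v) = B u v := by
  have hfd : Continuous (fderiv ℝ X) := hX.continuous_fderiv (by norm_num)
  have hcpt := isCompact_closedBall y₀ (1 : ℝ)
  obtain ⟨C₀, hC₀⟩ := hcpt.exists_bound_of_continuousOn hX.continuous.continuousOn
  obtain ⟨K₀, hK₀⟩ := hcpt.exists_bound_of_continuousOn hfd.continuousOn
  have hy₀ : y₀ ∈ closedBall y₀ (1 : ℝ) := mem_closedBall_self zero_le_one
  have hC0 : 0 ≤ C₀ := (norm_nonneg _).trans (hC₀ y₀ hy₀)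
  have hK0 : 0 ≤ K₀ := (norm_nonneg _).trans (hK₀ y₀ hy₀)
  lift K₀ to ℝ≥0 using hK0
  set ε : ℝ := 1 / (2 * (C₀ + 1 + K₀)) with hε
  have hpos : 0 < C₀ + 1 + K₀ := by positivity
  have hε0 : 0 < ε := by positivity
  have hεmul : (C₀ + 1 + K₀) * ε = 1 / 2 := by rw [hε]; field_simp
  have hKε : 0 ≤ K₀ * ε := by positivity
  have hCε : 0 ≤ (C₀ + 1) * ε := by positivity
  have hstay : ∀ y ∈ closedBall y₀ (1 / 2), ∀ t ∈ Icc 0 ε, Φ t y ∈ closedBall y₀ 1 :=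
    fun y hy t ht => flow_mem_closedBall hΦ0 hΦ (C := C₀ + 1)
      (fun x hx => (hC₀ x hx).trans_lt (lt_add_one _)) (by positivity) (by linarith) hy ht
  refine ⟨ε, hε0, ?_⟩
  filter_upwards [ball_mem_nhds y₀ (one_half_pos (α := ℝ))] with y hy t ht
  have hcont : Continuous fun s => Φ s y :=
    continuous_iff_continuousAt.2 fun t => (hΦ y t).continuousAt
  obtain ⟨M, hM0, hM⟩ := exists_hasDerivWithinAt_linear (A := fun t => fderiv ℝ X (Φ t y))
    hε0.le (hfd.comp hcont).continuousOn
    (fun t ht => hK₀ _ (hstay y (ball_subset_closedBall hy) t ht)) (by linarith)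
  refine ⟨M t, hasFDerivAt_flow_of_variational hX hΦ0 hΦ (convex_closedBall y₀ 1)
    (hcpt.uniformContinuousOn_of_continuous hfd.continuousOn) hK₀
    (by
      filter_upwards [isOpen_ball.mem_nhds hy] with z hz
      exact hstay z (ball_subset_closedBall hz)) hM0 hM ht, fun u v =>
    bilin_invariant_of_variational (fun τ => hB (Φ τ y)) hM0 hM u v ht⟩

/-- A bilinear form infinitesimally invariant along a complete vector field is invariant under the
derivative of its flow. -/
theorem exists_hasFDerivAt_flow [FiniteDimensional ℝ E] {X : E → E}
    (hX : ContDiff ℝ 1 X) {Φ : ℝ → E → E} (hΦ0 : ∀ x, Φ 0 x = x)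
    (hΦ : ∀ x t, HasDerivAt (fun s => Φ s x) (X (Φ t x)) t) {B : E →L[ℝ] E →L[ℝ] ℝ}
    (hB : ∀ x u v, B (fderiv ℝ X x u) v + B u (fderiv ℝ X x v) = 0) (t : ℝ) (x : E) :
    ∃ L : E →L[ℝ] E, HasFDerivAt (Φ t) L x ∧ ∀ u v, B (L u) (L v) = B u v := by
  have hadd := flow_add_of_contDiff hX hΦ0 hΦ
  have hcont : Continuous fun s => Φ s x :=
    continuous_iff_continuousAt.2 fun t => (hΦ x t).continuousAt
  have hlocal : ∀ y₀, ∃ ε > 0, ∀ᶠ y in 𝓝 y₀, ∀ t, |t| ≤ ε →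
      ∃ L : E →L[ℝ] E, HasFDerivAt (Φ t) L y ∧ ∀ u v, B (L u) (L v) = B u v := fun y₀ => by
    obtain ⟨ε₁, hε₁, h₁⟩ := exists_hasFDerivAt_flow_short_time hX hΦ0 hΦ hB y₀
    obtain ⟨ε₂, hε₂, h₂⟩ := exists_hasFDerivAt_flow_short_time (X := fun x => -X x)
      (Φ := fun t => Φ (-t)) (B := B) hX.neg (by simpa using hΦ0)
      (fun x t => by simpa [Function.comp_def] using (hΦ x (-t)).scomp t (hasDerivAt_neg t))
      (fun x u v => by
        have := hB x u v
        simp only [fderiv_fun_neg, neg_apply, map_neg]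
        linarith) y₀
    refine ⟨min ε₁ ε₂, lt_min hε₁ hε₂, ?_⟩
    filter_upwards [h₁, h₂] with y hy₁ hy₂ t ht
    rcases le_total 0 t with h | h
    · exact hy₁ t ⟨h, (le_abs_self t).trans (ht.trans (min_le_left _ _))⟩
    · simpa using hy₂ (-t) ⟨neg_nonneg.2 h, (neg_le_abs t).trans (ht.trans (min_le_right _ _))⟩
  set P : ℝ → Prop := fun t =>
    ∃ L : E →L[ℝ] E, HasFDerivAt (Φ t) L x ∧ ∀ u v, B (L u) (L v) = B u v with hP
  have hstep : ∀ s t, P s → (∃ L : E →L[ℝ] E, HasFDerivAt (Φ (t - s)) L (Φ s x) ∧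
      ∀ u v, B (L u) (L v) = B u v) → P t := by
    rintro s t ⟨L, hL, hLB⟩ ⟨L', hL', hLB'⟩
    refine ⟨L'.comp L, ?_, fun u v => by simp [hLB, hLB']⟩
    have hcomp : Φ t = Φ (t - s) ∘ Φ s := funext fun z => by
      rw [Function.comp_apply, ← hadd, sub_add_cancel]
    rw [hcomp]
    exact hL'.comp x hL
  have hiff : ∀ s, ∀ᶠ t in 𝓝 s, P s ↔ P t := fun s => by
    obtain ⟨ε, hε, hy⟩ := hlocal (Φ s x)
    filter_upwards [hcont.continuousAt.eventually hy, closedBall_mem_nhds s hε] with t ht hts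
    rw [mem_closedBall, Real.dist_eq] at hts
    exact ⟨fun h => hstep s t h (hy.self_of_nhds _ hts),
      fun h => hstep t s h (ht _ (by rwa [abs_sub_comm]))⟩
  have hclopen : IsClopen {t | P t} := by
    refine ⟨⟨isOpen_iff_mem_nhds.2 fun s hs => ?_⟩, isOpen_iff_mem_nhds.2 fun s hs => ?_⟩
    · filter_upwards [hiff s] with t ht h using hs (ht.2 h)
    · filter_upwards [hiff s] with t ht using ht.1 hs
  have hP0 : P 0 := ⟨ContinuousLinearMap.id ℝ E,
    funext hΦ0 ▸ hasFDerivAt_id x, fun _ _ => rfl⟩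
  exact (hclopen.eq_univ ⟨0, hP0⟩ ▸ mem_univ t : t ∈ {t | P t})

end Flow

theorem LinearMap.BilinForm.abs_det_eq_one_of_invariant {E : Type*} [AddCommGroup E] [Module ℝ E]
    [FiniteDimensional ℝ E] {B : LinearMap.BilinForm ℝ E} (hB : B.Nondegenerate)
    {L : E →ₗ[ℝ] E} (hL : ∀ u v, B (L u) (L v) = B u v) : |LinearMap.det L| = 1 := by
  classical
  let b := Module.finBasis ℝ E
  have hcomp : B.comp L L = B := by
    ext u v
    exact hL u v
  have hdet := congrArg Matrix.det (LinearMap.BilinForm.toMatrix_comp b b B L L)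
  have hne := (LinearMap.BilinForm.nondegenerate_iff_det_ne_zero b).1 hB
  rw [hcomp, Matrix.det_mul, Matrix.det_mul, Matrix.det_transpose, LinearMap.det_toMatrix] at hdet
  rw [← abs_one, ← sq_eq_sq_iff_abs_eq_abs]
  exact mul_right_cancel₀ hne (by linarith)

/-- The flow of a complete vector field leaving a nondegenerate bilinear form infinitesimally
invariant preserves Haar measures. -/
theorem addHaar_image_flow_of_invariant {E : Type*} [NormedAddCommGroup E] [NormedSpace ℝ E]
    [FiniteDimensional ℝ E] [MeasurableSpace E] [BorelSpace E] (μ : Measure E)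
    [μ.IsAddHaarMeasure] {X : E → E} (hX : ContDiff ℝ 1 X) {Φ : ℝ → E → E}
    (hΦ0 : ∀ x, Φ 0 x = x) (hΦ : ∀ x t, HasDerivAt (fun s => Φ s x) (X (Φ t x)) t)
    {B : E →L[ℝ] E →L[ℝ] ℝ} (hBnd : B.toLinearMap₁₂.Nondegenerate)
    (hB : ∀ x u v, B (fderiv ℝ X x u) v + B u (fderiv ℝ X x v) = 0) (t : ℝ) {A : Set E}
    (hA : MeasurableSet A) : μ (Φ t '' A) = μ A := by
  choose L hL hLB using exists_hasFDerivAt_flow hX hΦ0 hΦ hB t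
  have hinj : Function.Injective (Φ t) :=
    Function.LeftInverse.injective (g := Φ (-t)) fun x => by
      rw [← flow_add_of_contDiff hX hΦ0 hΦ, neg_add_cancel, hΦ0]
  have hdet : ∀ x, |(L x).det| = 1 := fun x =>
    LinearMap.BilinForm.abs_det_eq_one_of_invariant hBnd (L := (L x).toLinearMap) (hLB x)
  rw [← lintegral_abs_det_fderiv_eq_addHaar_image μ hA (fun x _ => (hL x).hasFDerivWithinAt)
    hinj.injOn]
  simp [hdet]

/-- A vector field dual to an exact form under a skew-symmetric bilinear form leaves this form
infinitesimally invariant. -/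
theorem bilin_fderiv_eq_zero_of_potential {E : Type*} [NormedAddCommGroup E] [NormedSpace ℝ E]
    {H : E → ℝ} (hH : ContDiff ℝ 2 H) {X : E → E} (hX : ContDiff ℝ 1 X)
    {B : E →L[ℝ] E →L[ℝ] ℝ} (hskew : ∀ u v, B u v = -B v u)
    (hB : ∀ x v, B (X x) v = fderiv ℝ H x v) (x u v : E) :
    B (fderiv ℝ X x u) v + B u (fderiv ℝ X x v) = 0 := by
  have hX' : HasFDerivAt X (fderiv ℝ X x) x := (hX.differentiable (by norm_num) x).hasFDerivAt
  have heq : fderiv ℝ H = fun x => B (X x) :=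
    funext fun x => ContinuousLinearMap.ext fun v => (hB x v).symm
  have hcomp : HasFDerivAt (fun x => B (X x)) (B.comp (fderiv ℝ X x)) x :=
    B.hasFDerivAt.comp x hX'
  have hhess : ∀ a b, B (fderiv ℝ X x a) b = fderiv ℝ (fderiv ℝ H) x a b := fun a b => by
    rw [heq, hcomp.fderiv, ContinuousLinearMap.comp_apply]
  have hsymm := hH.contDiffAt.isSymmSndFDerivAt (x := x) (by simp)
  rw [hskew u, hhess, hhess, hsymm.eq, add_neg_cancel]

section Hamiltonian

variable {V : Type*} [NormedAddCommGroup V] [InnerProductSpace ℝ V]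

variable (V) in
/-- The canonical symplectic form `((q₁, p₁), (q₂, p₂)) ↦ ⟪q₁, p₂⟫ - ⟪p₁, q₂⟫` on `V × V`. -/
noncomputable def canonicalSymplecticForm : V × V →L[ℝ] V × V →L[ℝ] ℝ :=
  (innerSL ℝ).bilinearComp (.fst ℝ V V) (.snd ℝ V V) -
    (innerSL ℝ).bilinearComp (.snd ℝ V V) (.fst ℝ V V)

theorem canonicalSymplecticForm_apply (u v : V × V) :
    canonicalSymplecticForm V u v = inner ℝ u.1 v.2 - inner ℝ u.2 v.1 := by
  simp [canonicalSymplecticForm]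

theorem canonicalSymplecticForm_swap (u v : V × V) :
    canonicalSymplecticForm V u v = -canonicalSymplecticForm V v u := by
  simp [canonicalSymplecticForm_apply, real_inner_comm]

theorem nondegenerate_canonicalSymplecticForm :
    (canonicalSymplecticForm V).toLinearMap₁₂.Nondegenerate := by
  have hleft : ∀ u : V × V, (∀ v, canonicalSymplecticForm V u v = 0) → u = 0 := fun u hu => by
    have h₁ := hu (0, u.1)
    have h₂ := hu (u.2, 0)
    simp only [canonicalSymplecticForm_apply, inner_zero_right, sub_zero, zero_sub, neg_eq_zero,
      inner_self_eq_zero] at h₁ h₂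
    exact Prod.ext h₁ h₂
  exact ⟨hleft, fun v hv => hleft v fun u => by
    rw [canonicalSymplecticForm_swap, neg_eq_zero]
    exact hv u⟩

variable [CompleteSpace V] {H : V × V → ℝ} {X : V × V → V × V}

theorem hamiltonianVectorField_eq (hH : Differentiable ℝ H)
    (hX : ∀ x, X x = (gradient (fun p => H (x.1, p)) x.2, -gradient (fun q => H (q, x.2)) x.1))
    (x : V × V) :
    X x = ((InnerProductSpace.toDual ℝ V).symm ((fderiv ℝ H x).comp (.inr ℝ V V)),
      -(InnerProductSpace.toDual ℝ V).symm ((fderiv ℝ H x).comp (.inl ℝ V V))) := by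
  have h₁ : HasFDerivAt (fun p => H (x.1, p)) ((fderiv ℝ H x).comp (.inr ℝ V V)) x.2 :=
    (hH x).hasFDerivAt.comp x.2 (hasFDerivAt_prodMk_right x.1 x.2)
  have h₂ : HasFDerivAt (fun q => H (q, x.2)) ((fderiv ℝ H x).comp (.inl ℝ V V)) x.1 :=
    (hH x).hasFDerivAt.comp x.1 (hasFDerivAt_prodMk_left x.1 x.2)
  rw [hX, gradient, gradient, h₁.fderiv, h₂.fderiv]

theorem contDiff_hamiltonianVectorField (hH : ContDiff ℝ 2 H)
    (hX : ∀ x, X x = (gradient (fun p => H (x.1, p)) x.2, -gradient (fun q => H (q, x.2)) x.1)) :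
    ContDiff ℝ 1 X := by
  have hfd : ContDiff ℝ 1 (fderiv ℝ H) := hH.fderiv_right (by norm_num)
  rw [funext (hamiltonianVectorField_eq (hH.differentiable (by norm_num)) hX)]
  exact ((InnerProductSpace.toDual ℝ V).symm.contDiff.comp (hfd.clm_comp contDiff_const)).prodMk
    ((InnerProductSpace.toDual ℝ V).symm.contDiff.comp (hfd.clm_comp contDiff_const)).neg

theorem canonicalSymplecticForm_hamiltonianVectorField (hH : Differentiable ℝ H)
    (hX : ∀ x, X x = (gradient (fun p => H (x.1, p)) x.2, -gradient (fun q => H (q, x.2)) x.1))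
    (x v : V × V) : canonicalSymplecticForm V (X x) v = fderiv ℝ H x v := by
  rw [hamiltonianVectorField_eq hH hX, canonicalSymplecticForm_apply]
  simp only [inner_neg_left, InnerProductSpace.toDual_symm_apply, sub_neg_eq_add,
    ContinuousLinearMap.comp_apply, ContinuousLinearMap.inr_apply, ContinuousLinearMap.inl_apply,
    ← map_add]
  simp

/-- Hamiltonian vector fields are infinitesimally symplectic. -/
theorem canonicalSymplecticForm_fderiv_hamiltonianVectorField (hH : ContDiff ℝ 2 H)
    (hX : ∀ x, X x = (gradient (fun p => H (x.1, p)) x.2, -gradient (fun q => H (q, x.2)) x.1))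
    (x u v : V × V) :
    canonicalSymplecticForm V (fderiv ℝ X x u) v +
      canonicalSymplecticForm V u (fderiv ℝ X x v) = 0 :=
  bilin_fderiv_eq_zero_of_potential hH (contDiff_hamiltonianVectorField hH hX)
    canonicalSymplecticForm_swap
    (canonicalSymplecticForm_hamiltonianVectorField (hH.differentiable (by norm_num)) hX) x u v

end Hamiltonian

/-- Liouville's theorem: the (globally defined) flow of the Hamiltonian vector
field `X(q,p) = (∂ₚH, −∂_qH)` on `ℝⁿ × ℝⁿ` preserves Lebesgue measure:
`λ(Φ_t(A)) = λ(A)` for every Borel set `A` and every time `t`. -/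
theorem liouville (n : ℕ)
    (H : EuclideanSpace ℝ (Fin n) × EuclideanSpace ℝ (Fin n) → ℝ)
    (hH : ContDiff ℝ 2 H)
    (X : EuclideanSpace ℝ (Fin n) × EuclideanSpace ℝ (Fin n) →
      EuclideanSpace ℝ (Fin n) × EuclideanSpace ℝ (Fin n))
    (hX : ∀ x, X x = (gradient (fun p => H (x.1, p)) x.2,
      -gradient (fun q => H (q, x.2)) x.1))
    (Φ : ℝ → EuclideanSpace ℝ (Fin n) × EuclideanSpace ℝ (Fin n) →
      EuclideanSpace ℝ (Fin n) × EuclideanSpace ℝ (Fin n))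
    (hΦ0 : ∀ x, Φ 0 x = x)
    (hΦ : ∀ x t, HasDerivAt (fun s => Φ s x) (X (Φ t x)) t) :
    ∀ (t : ℝ) (A : Set (EuclideanSpace ℝ (Fin n) × EuclideanSpace ℝ (Fin n))),
      MeasurableSet A → volume (Φ t '' A) = volume A := by
  have : (volume :
      Measure (EuclideanSpace ℝ (Fin n) × EuclideanSpace ℝ (Fin n))).IsAddHaarMeasure :=
    Measure.prod.instIsAddHaarMeasure _ _
  exact fun t A hA => addHaar_image_flow_of_invariant volume
    (contDiff_hamiltonianVectorField hH hX) hΦ0 hΦ nondegenerate_canonicalSymplecticForm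
    (canonicalSymplecticForm_fderiv_hamiltonianVectorField hH hX) t hA
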